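/- Let (v; w₀, …, w_{n−1}) be an embedded, immersed simplicial vertex star in ℝ³ whose Gauss image has no self-intersections and whose discrete Gaussian curvature K(v) is positive. Then the Gauss image is a convex spherical polygon: for every index i there is a sign ε ∈ {−1, 1} such that ε · ⟨nⱼ, nᵢ × nᵢ₊₁⟩ ≥ 0 for all j, i.e., all face normals lie in one closed half-space bounded by the plane spanned by nᵢ and nᵢ₊₁. (Theorem 2.8 (i), simplicial case: convexity of the Gauss image.) -/

import Mathlib

open RealInnerProductSpace

noncomputable section

/-- Euclidean 3-space. -/
abbrev E3 : Type := EuclideanSpace ℝ (Fin 3)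

/-- The cross product on `E3`. -/
noncomputable def cross3 (a b : E3) : E3 :=
  (WithLp.equiv 2 (Fin 3 → ℝ)).symm
    ![a 1 * b 2 - a 2 * b 1, a 2 * b 0 - a 0 * b 2, a 0 * b 1 - a 1 * b 0]

/-- The face `Tᵢ = conv {v, wᵢ, wᵢ₊₁}` of a simplicial vertex star `(v; w)`;
indices are taken modulo `n`. -/
def starFace {n : ℕ} (v : E3) (w : ZMod n → E3) (i : ZMod n) : Set E3 :=
  convexHull ℝ {v, w i, w (i + 1)}

/-- The unnormalized face normal `mᵢ = (wᵢ − v) × (wᵢ₊₁ − v)`. -/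
noncomputable def starFN {n : ℕ} (v : E3) (w : ZMod n → E3) (i : ZMod n) : E3 :=
  cross3 (w i - v) (w (i + 1) - v)

/-- The unit face normal `nᵢ = mᵢ / ‖mᵢ‖`. -/
noncomputable def starUN {n : ℕ} (v : E3) (w : ZMod n → E3) (i : ZMod n) : E3 :=
  ‖starFN v w i‖⁻¹ • starFN v w i

/-- `(v; w₀, …, w_{n−1})` is an embedded, immersed simplicial vertex star:
`n ≥ 3`; consecutive edge vectors are linearly independent; distinct faces meet
exactly in their common edge (adjacent case) or in `{v}` (non-adjacent case);
and consecutive unit normals satisfy `nᵢ₊₁ ≠ ±nᵢ`. -/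
def IsStar {n : ℕ} (v : E3) (w : ZMod n → E3) : Prop :=
  3 ≤ n ∧
  (∀ i : ZMod n, LinearIndependent ℝ ![w i - v, w (i + 1) - v]) ∧
  (∀ i : ZMod n, starUN v w (i + 1) ≠ starUN v w i ∧ starUN v w (i + 1) ≠ -starUN v w i) ∧
  (∀ i j : ZMod n, i ≠ j →
    (j = i + 1 → starFace v w i ∩ starFace v w j = segment ℝ v (w j)) ∧
    (i = j + 1 → starFace v w i ∩ starFace v w j = segment ℝ v (w i)) ∧
    (j ≠ i + 1 → i ≠ j + 1 → starFace v w i ∩ starFace v w j = {v}))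

/-- The shorter great-circle arc `Arc(p, q)` joining two unit vectors `p ≠ ±q`. -/
def sArc (p q : E3) : Set E3 :=
  {x | ∃ s t : ℝ, 0 ≤ s ∧ 0 ≤ t ∧ 0 < s + t ∧ x = ‖s • p + t • q‖⁻¹ • (s • p + t • q)}

/-- The Gauss image of the vertex star (the spherical polygon with vertices `nᵢ` and
edges `Arc(nᵢ, nᵢ₊₁)`) has no self-intersections. -/
def GaussEmb {n : ℕ} (v : E3) (w : ZMod n → E3) : Prop :=
  Function.Injective (starUN v w) ∧
  ∀ i j : ZMod n, i ≠ j →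
    (j = i + 1 →
      sArc (starUN v w i) (starUN v w (i + 1)) ∩ sArc (starUN v w j) (starUN v w (j + 1)) =
        {starUN v w j}) ∧
    (i = j + 1 →
      sArc (starUN v w i) (starUN v w (i + 1)) ∩ sArc (starUN v w j) (starUN v w (j + 1)) =
        {starUN v w i}) ∧
    (j ≠ i + 1 → i ≠ j + 1 →
      sArc (starUN v w i) (starUN v w (i + 1)) ∩ sArc (starUN v w j) (starUN v w (j + 1)) = ∅)

/-- The discrete Gaussian curvature (angle defect)
`K(v) = 2π − Σᵢ ∠(wᵢ − v, wᵢ₊₁ − v)`. -/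
noncomputable def curv {n : ℕ} [NeZero n] (v : E3) (w : ZMod n → E3) : ℝ :=
  2 * Real.pi - ∑ i : ZMod n, InnerProductGeometry.angle (w i - v) (w (i + 1) - v)

/-- The face `Tᵢ` is an inflection face: its two neighboring faces lie strictly on
opposite sides of its plane. -/
def IsInflectionFace {n : ℕ} (v : E3) (w : ZMod n → E3) (i : ZMod n) : Prop :=
  ⟪w (i - 1) - v, starFN v w i⟫ * ⟪w (i + 2) - v, starFN v w i⟫ < 0

/-- The carrier `Star = ⋃ᵢ Tᵢ` of the vertex star. -/
def starCarrier {n : ℕ} (v : E3) (w : ZMod n → E3) : Set E3 :=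
  ⋃ i : ZMod n, starFace v w i

open Complex in
/-- An argument is determined by its class modulo `2π`. -/
lemma arg_eq_of_coe {w : ℂ} {θ : ℝ} (h : ((arg w : ℝ) : Real.Angle) = (θ : Real.Angle))
    (h1 : -Real.pi < θ) (h2 : θ ≤ Real.pi) : arg w = θ := by
  have := Real.Angle.toReal_coe_eq_self_iff.2 ⟨h1, h2⟩
  rw [← this, ← h]
  exact (Real.Angle.toReal_coe_eq_self_iff.2 ⟨neg_pi_lt_arg w, arg_le_pi w⟩).symm

open Complex in
lemma arg_div_of_sub {x y : ℂ} (hx : x ≠ 0) (hy : y ≠ 0) (h1 : -Real.pi < arg x - arg y)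
    (h2 : arg x - arg y ≤ Real.pi) : arg (x / y) = arg x - arg y := by
  apply arg_eq_of_coe _ h1 h2
  rw [arg_div_coe_angle hx hy]; simp

open Complex in
lemma arg_neg_div_of_lt {x y : ℂ} (hx : x ≠ 0) (hy : y ≠ 0) (h1 : 0 < arg x - arg y)
    (h2 : arg x - arg y < Real.pi) : arg (-x / y) = arg x - arg y - Real.pi := by
  apply arg_eq_of_coe _ (by linarith) (by linarith)
  rw [arg_div_coe_angle (neg_ne_zero.2 hx) hy, arg_neg_coe_angle hx]
  rw [Real.Angle.coe_sub, Real.Angle.coe_sub]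
  rw [sub_eq_add_neg _ (Real.pi : Real.Angle), Real.Angle.neg_coe_pi]
  abel

open Complex in
lemma arg_neg_div_of_gt {x y : ℂ} (hx : x ≠ 0) (hy : y ≠ 0) (h1 : arg x - arg y < 0)
    (h2 : -Real.pi < arg x - arg y) : arg (-x / y) = arg x - arg y + Real.pi := by
  apply arg_eq_of_coe _ (by linarith) (by linarith)
  rw [arg_div_coe_angle (neg_ne_zero.2 hx) hy, arg_neg_coe_angle hx]
  rw [Real.Angle.coe_add, Real.Angle.coe_sub]
  abel

open Complex in
/-- For points of the closed upper half plane multiplication by `-I` lowers the argument. -/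
lemma arg_negI_mul {d : ℂ} (hd : d ≠ 0) (h : 0 ≤ d.im) : arg (-I * d) = arg d - Real.pi / 2 := by
  have h0 := arg_nonneg_iff.2 h
  have h1 := arg_le_pi d
  have hp := Real.pi_pos
  apply arg_eq_of_coe _ (by linarith) (by linarith)
  rw [arg_mul_coe_angle (by simp) hd, arg_neg_I]
  rw [add_comm, sub_eq_add_neg]
  congr 1

open Complex in
lemma cross_eq_sin (x y : ℂ) :
    x.re * y.im - x.im * y.re = ‖x‖ * ‖y‖ * Real.sin (arg y - arg x) := by
  rw [Real.sin_sub]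
  have h1 := norm_mul_cos_arg x
  have h2 := norm_mul_sin_arg x
  have h3 := norm_mul_cos_arg y
  have h4 := norm_mul_sin_arg y
  rw [← h1, ← h2, ← h3, ← h4]
  ring

open Complex in
/-- In the range of arguments under consideration, the sign of the cross product compares the
arguments. -/
lemma cross_pos_iff {x y : ℂ} (hx : x ≠ 0) (hy : y ≠ 0) (h1 : -Real.pi < arg y - arg x)
    (h2 : arg y - arg x < Real.pi) :
    0 < x.re * y.im - x.im * y.re ↔ 0 < arg y - arg x := by
  rw [cross_eq_sin]
  have hp : 0 < ‖x‖ * ‖y‖ := by positivity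
  rw [mul_pos_iff_of_pos_left hp]
  constructor
  · intro h
    by_contra hc
    have := Real.sin_nonpos_of_nonpos_of_neg_pi_le (not_lt.1 hc) h1.le
    linarith
  · intro h
    exact Real.sin_pos_of_pos_of_lt_pi h h2

/-- The region: open upper half plane together with the open interval `(0, β)`. -/
def HReg (β : ℝ) : Set ℂ := {x | 0 < x.im ∨ (x.im = 0 ∧ 0 < x.re ∧ x.re < β)}

lemma HReg_im {β : ℝ} {x : ℂ} (h : x ∈ HReg β) : 0 ≤ x.im := by
  rcases h with h | h
  · exact h.le
  · exact h.1.ge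

lemma HReg_convex (β : ℝ) : Convex ℝ (HReg β) := by
  intro x hx y hy s t hs ht hst
  have hxi := HReg_im hx
  have hyi := HReg_im hy
  have him : (s • x + t • y).im = s * x.im + t * y.im := by simp
  have hre : (s • x + t • y).re = s * x.re + t * y.re := by simp
  rcases hs.eq_or_lt with hs0 | hs0
  · have : t = 1 := by linarith
    subst hs0; subst this; simpa using hy
  rcases ht.eq_or_lt with ht0 | ht0
  · have : s = 1 := by linarith
    subst ht0; subst this; simpa using hx
  rcases hx with hx | ⟨hx1, hx2, hx3⟩
  · left; rw [him]; positivity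
  rcases hy with hy | ⟨hy1, hy2, hy3⟩
  · left; rw [him]; positivity
  right
  rw [him, hre, hx1, hy1]
  refine ⟨by simp, by positivity, ?_⟩
  have : β = s * β + t * β := by rw [← add_mul, hst, one_mul]
  rw [this]
  gcongr

lemma HReg_zero {β : ℝ} {x : ℂ} (h : x ∈ HReg β) {ε : ℝ} (h0 : 0 < ε) (h1 : ε ≤ 1) :
    (ε : ℂ) * x ∈ HReg β := by
  rcases h with h | ⟨a, b, c⟩
  · left; simp; positivity
  · right; simp [a]; exact ⟨by positivity, by nlinarith⟩

lemma HReg_beta {β : ℝ} {x : ℂ} (h : x ∈ HReg β) {ε : ℝ} (h0 : 0 < ε) (h1 : ε ≤ 1) :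
    (β : ℂ) + (ε : ℂ) * (x - β) ∈ HReg β := by
  rcases h with h | ⟨a, b, c⟩
  · left; simp; positivity
  · right; simp [a]; exact ⟨by nlinarith, by nlinarith⟩

lemma HReg_ne_zero {β : ℝ} {x : ℂ} (h : x ∈ HReg β) : x ≠ 0 := by
  rintro rfl
  rcases h with h | h <;> simp at h

lemma HReg_ne_beta {β : ℝ} {x : ℂ} (h : x ∈ HReg β) : x ≠ β := by
  rintro rfl
  rcases h with h | h <;> simp at h

lemma HReg_arg {β : ℝ} {x : ℂ} (h : x ∈ HReg β) : 0 ≤ x.arg ∧ x.arg < Real.pi := by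
  refine ⟨Complex.arg_nonneg_iff.2 (HReg_im h), lt_of_le_of_ne (Complex.arg_le_pi x) ?_⟩
  intro hc
  rw [Complex.arg_eq_pi_iff] at hc
  rcases h with h | h <;> linarith

lemma HReg_arg_beta {β : ℝ} {x : ℂ} (h : x ∈ HReg β) :
    0 < (x - β).arg ∧ (x - β).arg ≤ Real.pi := by
  have hi : (0:ℝ) ≤ (x - β).im := by simpa using HReg_im h
  refine ⟨lt_of_le_of_ne (Complex.arg_nonneg_iff.2 hi) ?_, Complex.arg_le_pi _⟩
  intro hc
  have := (Complex.arg_eq_zero_iff.1 hc.symm)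
  simp at this
  rcases h with h | h <;> linarith

open Complex in
/-- The winding function of a path `z 0, …, z k`, closed up by two downward vertical rays. -/
noncomputable def Wd (z : ℕ → ℂ) (k : ℕ) (x : ℂ) : ℝ :=
  arg (I * (z 0 - x)) - arg (I * (z k - x)) +
    ∑ i ∈ Finset.range k, arg ((z (i + 1) - x) / (z i - x))

open Complex in
lemma Wd_mem (z : ℕ → ℂ) (k : ℕ) (x : ℂ) (h : ∀ i ≤ k, x ≠ z i) :
    Wd z k x ∈ AddSubgroup.zmultiples (2 * Real.pi) := by
  rw [AddSubgroup.mem_zmultiples_iff]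
  rw [← Real.Angle.coe_eq_zero_iff]
  have h' : ∀ i ≤ k, z i - x ≠ 0 := fun i hi => sub_ne_zero.2 (h i hi).symm
  have hs : ((∑ i ∈ Finset.range k, arg ((z (i + 1) - x) / (z i - x)) : ℝ) : Real.Angle)
      = (arg (z k - x) : Real.Angle) - (arg (z 0 - x) : Real.Angle) := by
    rw [← Finset.sum_range_sub (fun i => ((arg (z i - x) : ℝ) : Real.Angle)),
      ← Real.Angle.coe_coeHom, map_sum]
    apply Finset.sum_congr rfl
    intro i hi
    rw [Finset.mem_range] at hi
    rw [Real.Angle.coe_coeHom, arg_div_coe_angle (h' _ (by omega)) (h' _ (by omega))]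
  unfold Wd
  rw [Real.Angle.coe_add, Real.Angle.coe_sub]
  rw [arg_mul_coe_angle I_ne_zero (h' 0 (by omega)), arg_mul_coe_angle I_ne_zero (h' k le_rfl), hs]
  abel

open Complex in
lemma slit_of_not_mem {p q x : ℂ} (h : x ∉ segment ℝ p q) : (q - x) / (p - x) ∈ slitPlane := by
  by_contra hc
  apply h
  have hp : p - x ≠ 0 := by
    intro h0
    have : x = p := (sub_eq_zero.1 h0).symm
    exact h (this ▸ left_mem_segment ℝ p q)
  set c := (q - x) / (p - x) with hcdef
  have hq : q - x = c * (p - x) := by rw [hcdef]; field_simp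
  rw [mem_slitPlane_iff, not_or, not_lt, not_not] at hc
  have hcr : c = ((c.re : ℝ) : ℂ) := by apply Complex.ext <;> simp [hc.2]
  set r := c.re with hr
  rw [hcr] at hq
  have h1 : 0 < 1 - r := by linarith [hc.1]
  refine ⟨-r / (1 - r), 1 / (1 - r), div_nonneg (by linarith [hc.1]) h1.le, by positivity, by field_simp; ring, ?_⟩
  have h1c : (1 - r : ℂ) ≠ 0 := by exact_mod_cast h1.ne'
  have hqe : q = x + r * (p - x) := by linear_combination hq
  rw [hqe]
  simp only [real_smul]
  push_cast
  field_simp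
  ring

open Complex in
lemma slit_I {p x : ℂ} (h : p.im ≤ x.im) (hne : x ≠ p) : I * (p - x) ∈ slitPlane := by
  rw [mem_slitPlane_iff]
  simp
  by_contra hc
  push Not at hc
  apply hne
  apply Complex.ext <;> linarith [hc.1, hc.2]

open Complex in
lemma Wd_cont (β : ℝ) (z : ℕ → ℂ) (k : ℕ) (h0 : z 0 = 0) (hk : z k = β) (x : ℂ) (hx : x ∈ HReg β)
    (h : ∀ i < k, x ∉ segment ℝ (z i) (z (i + 1))) : ContinuousAt (Wd z k) x := by
  unfold Wd
  apply ContinuousAt.add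
  · apply ContinuousAt.sub
    · have := slit_I (p := z 0) (x := x) (by simpa [h0] using HReg_im hx)
        (by rw [h0]; exact HReg_ne_zero hx)
      exact (continuousAt_arg this).comp (f := fun x => I * (z 0 - x)) (by fun_prop)
    · have := slit_I (p := z k) (x := x) (by simpa [hk] using HReg_im hx)
        (by rw [hk]; exact HReg_ne_beta hx)
      exact (continuousAt_arg this).comp (f := fun x => I * (z k - x)) (by fun_prop)
  · apply tendsto_finsetSum
    intro i hi
    rw [Finset.mem_range] at hi
    have := slit_of_not_mem (h i hi)
    have hne : z i - x ≠ 0 := by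
      intro h0
      have : x = z i := (sub_eq_zero.1 h0).symm
      exact h i hi (this ▸ left_mem_segment ℝ _ _)
    exact (continuousAt_arg this).comp (f := fun x => (z (i + 1) - x) / (z i - x))
      (by fun_prop (disch := assumption))

/-- The winding function is constant on convex sets avoiding the path. -/
lemma Wd_const (β : ℝ) (z : ℕ → ℂ) (k : ℕ) (hk1 : 0 < k) (h0 : z 0 = 0) (hk : z k = β)
    (S : Set ℂ) (hS : Convex ℝ S) (hSH : S ⊆ HReg β)
    (h : ∀ x ∈ S, ∀ i < k, x ∉ segment ℝ (z i) (z (i + 1))) {x y : ℂ} (hx : x ∈ S) (hy : y ∈ S) :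
    Wd z k x = Wd z k y := by
  have hd : IsDiscrete (AddSubgroup.zmultiples (2 * Real.pi) : Set ℝ) := ⟨inferInstanceAs (DiscreteTopology (AddSubgroup.zmultiples (2 * Real.pi)))⟩
  refine hS.isPreconnected.constant_of_mapsTo hd (f := Wd z k) ?_ ?_ hx hy
  · intro x hx
    exact (Wd_cont β z k h0 hk x (hSH hx) (h x hx)).continuousWithinAt
  · intro x hx
    apply Wd_mem
    intro i hi hc
    rcases hi.eq_or_lt with rfl | hi
    · exact HReg_ne_beta (hSH hx) (hc.trans hk)
    · exact h x hx i hi (hc ▸ left_mem_segment ℝ _ _)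


open Complex in
lemma slit_of_arg {x y : ℂ} (hx : x ≠ 0) (hy : y ≠ 0) (h1 : -Real.pi < arg x - arg y)
    (h2 : arg x - arg y < Real.pi) : x / y ∈ slitPlane := by
  rw [mem_slitPlane_iff_arg]
  refine ⟨?_, div_ne_zero hx hy⟩
  rw [arg_div_of_sub hx hy h1 h2.le]
  exact h2.ne

open Complex in
lemma slit_neg_div {x y : ℂ} (hx : x ≠ 0) (hy : y ≠ 0) (h1 : -Real.pi < arg x - arg y)
    (h2 : arg x - arg y < Real.pi) (h3 : arg x - arg y ≠ 0) : -x / y ∈ slitPlane := by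
  rw [mem_slitPlane_iff_arg]
  refine ⟨?_, div_ne_zero (neg_ne_zero.2 hx) hy⟩
  rcases lt_or_gt_of_ne h3 with h | h
  · rw [arg_neg_div_of_gt hx hy h h1]; intro hc; linarith
  · rw [arg_neg_div_of_lt hx hy h h2]; intro hc; linarith

open Filter Topology in
/-- If `G` is continuous at `0` and equals `c` on `(0, 1]` then `G 0 = c`. -/
lemma limit_eq {G : ℝ → ℝ} {c : ℝ} (hG : ContinuousAt G 0)
    (h : ∀ ε : ℝ, 0 < ε → ε ≤ 1 → G ε = c) : G 0 = c := by
  have h1 : Tendsto G (𝓝[>] 0) (𝓝 (G 0)) := hG.tendsto.mono_left nhdsWithin_le_nhds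
  have h2 : Tendsto G (𝓝[>] 0) (𝓝 c) := by
    apply tendsto_const_nhds.congr'
    filter_upwards [Ioc_mem_nhdsGT (zero_lt_one' ℝ)] with ε hε
    exact (h ε hε.1 hε.2).symm
  exact tendsto_nhds_unique h1 h2

open Complex in
lemma Wd_at_zero (β : ℝ) (hβ : 0 < β) (z : ℕ → ℂ) (k : ℕ) (h0 : z 0 = 0)
    (hk : z (k + 1) = β) (hz : ∀ i, 0 < i → i < k + 1 → z i ∈ HReg β) (hk1 : 0 < k)
    (d : ℂ) (hd : d ∈ HReg β) (c : ℝ)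
    (hc : ∀ ε : ℝ, 0 < ε → ε ≤ 1 → Wd z (k + 1) (ε * d) = c)
    (hne : d.re * (z 1).im - d.im * (z 1).re ≠ 0) :
    (0 < d.re * (z 1).im - d.im * (z 1).re → c = -(2 * Real.pi)) ∧
    (d.re * (z 1).im - d.im * (z 1).re < 0 → c = 0) := by
  have hpi := Real.pi_pos
  have hd0 := HReg_ne_zero hd
  have hda := HReg_arg hd
  have hz1 := hz 1 one_pos (by omega)
  have hz10 := HReg_ne_zero hz1
  have hz1a := HReg_arg hz1
  have hβ0 : (β : ℂ) ≠ 0 := by exact_mod_cast hβ.ne'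
  have hn : ∀ i, i < k + 1 → z (i + 1) ≠ 0 := by
    intro i hi
    rcases (Nat.lt_succ_iff.1 hi).eq_or_lt with h | h
    · subst h; rw [hk]; exact hβ0
    · exact HReg_ne_zero (hz _ (by omega) (by omega))
  have ha : ∀ i, i < k + 1 → 0 ≤ arg (z (i + 1)) ∧ arg (z (i + 1)) < Real.pi := by
    intro i hi
    rcases (Nat.lt_succ_iff.1 hi).eq_or_lt with h | h
    · subst h; rw [hk, arg_ofReal_of_nonneg hβ.le]; exact ⟨le_rfl, hpi⟩
    · exact HReg_arg (hz _ (by omega) (by omega))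
  have hcr := cross_pos_iff hd0 hz10 (by linarith) (by linarith)
  have hane : arg (z 1) - arg d ≠ 0 := by
    intro h
    rw [cross_eq_sin, h] at hne
    simp at hne
  let G : ℝ → ℝ := fun ε => arg (-I * d) - arg (I * (β - ε * d)) +
    (∑ i ∈ Finset.range k, arg ((z (i + 2) - ε * d) / (z (i + 1) - ε * d)) +
      arg (-(z 1 - ε * d) / d))
  have hGc : ContinuousAt G 0 := by
    apply ContinuousAt.add
    · apply ContinuousAt.sub continuousAt_const
      have : I * (β - ((0:ℝ):ℂ) * d) ∈ slitPlane := by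
        rw [mem_slitPlane_iff]; right; simp [hβ.ne']
      exact (continuousAt_arg this).comp (f := fun ε : ℝ => I * (β - ε * d)) (by fun_prop)
    · apply ContinuousAt.add
      · apply tendsto_finsetSum
        intro i hi
        rw [Finset.mem_range] at hi
        have h1 := ha i (by omega)
        have h2 := ha (i + 1) (by omega)
        have : (z (i + 2) - ((0:ℝ):ℂ) * d) / (z (i + 1) - ((0:ℝ):ℂ) * d) ∈ slitPlane := by
          simp only [ofReal_zero, zero_mul, sub_zero]
          exact slit_of_arg (hn _ (by omega)) (hn _ (by omega)) (by linarith) (by linarith)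
        have hne : z (i + 1) - ((0:ℝ):ℂ) * d ≠ 0 := by simpa using hn i (by omega)
        exact (continuousAt_arg this).comp
          (f := fun ε : ℝ => (z (i + 2) - ε * d) / (z (i + 1) - ε * d))
          (by fun_prop (disch := assumption))
      · have : -(z 1 - ((0:ℝ):ℂ) * d) / d ∈ slitPlane := by
          simp only [ofReal_zero, zero_mul, sub_zero]
          exact slit_neg_div hz10 hd0 (by linarith) (by linarith) hane
        exact (continuousAt_arg this).comp (f := fun ε : ℝ => -(z 1 - ε * d) / d)
          (by fun_prop)
  have hGe : ∀ ε : ℝ, 0 < ε → ε ≤ 1 → G ε = c := by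
    intro ε h1 h2
    rw [← hc ε h1 h2]
    have hεc : (ε : ℂ) ≠ 0 := by exact_mod_cast h1.ne'
    simp only [G, Wd]
    rw [Finset.sum_range_succ', h0, hk]
    congr 1
    · congr 1
      rw [← arg_real_mul _ h1]; congr 1; ring
    · congr 1
      rw [← arg_real_mul _ (inv_pos.2 h1)]
      congr 1
      push_cast
      field_simp
      ring
  have hlim := limit_eq hGc hGe
  have hsum : ∑ i ∈ Finset.range k, arg ((z (i + 2)) / (z (i + 1))) = - arg (z 1) := by
    have : ∑ i ∈ Finset.range k, arg ((z (i + 2)) / (z (i + 1)))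
        = ∑ i ∈ Finset.range k, (arg (z (i + 1 + 1)) - arg (z (i + 1))) := by
      apply Finset.sum_congr rfl
      intro i hi
      rw [Finset.mem_range] at hi
      have h1 := ha i (by omega)
      have h2 := ha (i + 1) (by omega)
      exact arg_div_of_sub (hn _ (by omega)) (hn _ (by omega)) (by linarith) (by linarith)
    rw [this, Finset.sum_range_sub (fun i => arg (z (i + 1))), hk, arg_ofReal_of_nonneg hβ.le]
    simp
  have hIb : arg (I * (β : ℂ)) = Real.pi / 2 := by
    rw [arg_mul_real hβ, arg_I]
  simp only [G, ofReal_zero, zero_mul, sub_zero] at hlim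
  rw [hsum, hIb, arg_negI_mul hd0 (HReg_im hd)] at hlim
  constructor
  · intro h
    have h' := hcr.1 h
    rw [arg_neg_div_of_lt hz10 hd0 h' (by linarith)] at hlim
    linarith
  · intro h
    have h' : arg (z 1) - arg d < 0 := by
      rcases lt_or_gt_of_ne hane with h1 | h1
      · exact h1
      · have := hcr.2 h1; linarith
    rw [arg_neg_div_of_gt hz10 hd0 h' (by linarith)] at hlim
    linarith

open Complex in
lemma Wd_at_beta (β : ℝ) (hβ : 0 < β) (z : ℕ → ℂ) (k : ℕ) (h0 : z 0 = 0)
    (hk : z (k + 1) = β) (hz : ∀ i, 0 < i → i < k + 1 → z i ∈ HReg β) (hk1 : 0 < k)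
    (d g : ℂ) (hd : d + β ∈ HReg β) (hg : g = z k - β) (c : ℝ)
    (hc : ∀ ε : ℝ, 0 < ε → ε ≤ 1 → Wd z (k + 1) (β + ε * d) = c)
    (hne : g.re * d.im - g.im * d.re ≠ 0) :
    (0 < g.re * d.im - g.im * d.re → c = -(2 * Real.pi)) ∧
    (g.re * d.im - g.im * d.re < 0 → c = 0) := by
  have hpi := Real.pi_pos
  have hd0 : d ≠ 0 := by
    rintro rfl
    exact HReg_ne_beta hd (by simp)
  have hda := HReg_arg_beta hd
  rw [add_sub_cancel_right] at hda
  have hdi : 0 ≤ d.im := by simpa using HReg_im hd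
  have hzk := hz k hk1 (by omega)
  have hg0 : g ≠ 0 := by
    rw [hg]; exact sub_ne_zero.2 (HReg_ne_beta hzk)
  have hga := HReg_arg_beta hzk
  rw [← hg] at hga
  have hβ0 : (β : ℂ) ≠ 0 := by exact_mod_cast hβ.ne'
  have hargb : arg (-(β : ℂ)) = Real.pi := by
    rw [← ofReal_neg, arg_ofReal_of_neg (by linarith)]
  have hn : ∀ i, i < k + 1 → z i - β ≠ 0 := by
    intro i hi
    rcases Nat.eq_zero_or_pos i with h | h
    · subst h; rw [h0]; simpa using hβ.ne'
    · exact sub_ne_zero.2 (HReg_ne_beta (hz _ (by omega) (by omega)))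
  have ha : ∀ i, i < k + 1 → 0 < arg (z i - β) ∧ arg (z i - β) ≤ Real.pi := by
    intro i hi
    rcases Nat.eq_zero_or_pos i with h | h
    · subst h; rw [h0, zero_sub, hargb]; exact ⟨hpi, le_rfl⟩
    · exact HReg_arg_beta (hz _ (by omega) (by omega))
  have hcr := cross_pos_iff hg0 hd0 (by linarith) (by linarith)
  have hane : arg d - arg g ≠ 0 := by
    intro h
    rw [cross_eq_sin, h] at hne
    simp at hne
  let G : ℝ → ℝ := fun ε => arg (I * (0 - (β + ε * d))) - arg (-I * d) +
    (∑ i ∈ Finset.range k, arg ((z (i + 1) - (β + ε * d)) / (z i - (β + ε * d))) +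
      arg (-d / (g - ε * d)))
  have hGc : ContinuousAt G 0 := by
    apply ContinuousAt.add
    · apply ContinuousAt.sub _ continuousAt_const
      have : I * (0 - (β + ((0:ℝ):ℂ) * d)) ∈ slitPlane := by
        rw [mem_slitPlane_iff]; right; simp [hβ.ne']
      exact (continuousAt_arg this).comp (f := fun ε : ℝ => I * (0 - (β + ε * d))) (by fun_prop)
    · apply ContinuousAt.add
      · apply tendsto_finsetSum
        intro i hi
        rw [Finset.mem_range] at hi
        have h1 := ha i (by omega)
        have h2 := ha (i + 1) (by omega)
        have : (z (i + 1) - (β + ((0:ℝ):ℂ) * d)) / (z i - (β + ((0:ℝ):ℂ) * d)) ∈ slitPlane := by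
          simp only [ofReal_zero, zero_mul, add_zero]
          exact slit_of_arg (hn _ (by omega)) (hn _ (by omega)) (by linarith) (by linarith)
        have hne : z i - (β + ((0:ℝ):ℂ) * d) ≠ 0 := by simpa using hn i (by omega)
        exact (continuousAt_arg this).comp
          (f := fun ε : ℝ => (z (i + 1) - (β + ε * d)) / (z i - (β + ε * d)))
          (by fun_prop (disch := assumption))
      · have : -d / (g - ((0:ℝ):ℂ) * d) ∈ slitPlane := by
          simp only [ofReal_zero, zero_mul, sub_zero]
          exact slit_neg_div hd0 hg0 (by linarith) (by linarith) hane
        have hne : g - ((0:ℝ):ℂ) * d ≠ 0 := by simpa using hg0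
        exact (continuousAt_arg this).comp (f := fun ε : ℝ => -d / (g - ε * d))
          (by fun_prop (disch := assumption))
  have hGe : ∀ ε : ℝ, 0 < ε → ε ≤ 1 → G ε = c := by
    intro ε h1 h2
    rw [← hc ε h1 h2]
    have hεc : (ε : ℂ) ≠ 0 := by exact_mod_cast h1.ne'
    simp only [G, Wd]
    rw [Finset.sum_range_succ, h0, hk]
    congr 1
    · congr 1
      rw [← arg_real_mul _ h1]; congr 1; ring
    · congr 1
      rw [← arg_real_mul _ h1]
      congr 1
      rw [hg]
      ring
  have hlim := limit_eq hGc hGe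
  have hsum : ∑ i ∈ Finset.range k, arg ((z (i + 1) - β) / (z i - β)) = arg g - Real.pi := by
    have : ∑ i ∈ Finset.range k, arg ((z (i + 1) - β) / (z i - β))
        = ∑ i ∈ Finset.range k, (arg (z (i + 1) - β) - arg (z i - β)) := by
      apply Finset.sum_congr rfl
      intro i hi
      rw [Finset.mem_range] at hi
      have h1 := ha i (by omega)
      have h2 := ha (i + 1) (by omega)
      exact arg_div_of_sub (hn _ (by omega)) (hn _ (by omega)) (by linarith) (by linarith)
    rw [this, Finset.sum_range_sub (fun i => arg (z i - β)), h0, zero_sub, hargb, hg]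
  have hIb : arg (I * (0 - (β : ℂ))) = -(Real.pi / 2) := by
    have : I * (0 - (β : ℂ)) = -I * β := by ring
    rw [this, arg_mul_real hβ, arg_neg_I]
  simp only [G, ofReal_zero, zero_mul, sub_zero, add_zero] at hlim
  rw [hsum, hIb, arg_negI_mul hd0 hdi] at hlim
  constructor
  · intro h
    have h' := hcr.1 h
    rw [arg_neg_div_of_lt hd0 hg0 h' (by linarith)] at hlim
    linarith
  · intro h
    have h' : arg d - arg g < 0 := by
      rcases lt_or_gt_of_ne hane with h1 | h1
      · exact h1
      · have := hcr.2 h1; linarith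
    rw [arg_neg_div_of_gt hd0 hg0 h' (by linarith)] at hlim
    linarith

/-- The planar Jordan-type lemma: two paths from `0` to `β` in the upper half plane which are
disjoint except at their endpoints have consistent order at both endpoints. -/
lemma planar_order (β : ℝ) (hβ : 0 < β) (z u : ℕ → ℂ) (k m : ℕ) (hk1 : 0 < k) (hm1 : 0 < m)
    (hz0 : z 0 = 0) (hzk : z (k + 1) = β) (hz : ∀ i, 0 < i → i < k + 1 → z i ∈ HReg β)
    (hu0 : u 0 = 0) (hum : u (m + 1) = β) (hu : ∀ i, 0 < i → i < m + 1 → u i ∈ HReg β)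
    (hdis : ∀ i < k + 1, ∀ j < m + 1, ∀ x ∈ HReg β, x ∈ segment ℝ (z i) (z (i + 1)) →
      x ∈ segment ℝ (u j) (u (j + 1)) → False)
    (g d : ℂ) (hg : g = z k - β) (hd : d = u m - β)
    (hA : (u 1).re * (z 1).im - (u 1).im * (z 1).re ≠ 0)
    (hB : g.re * d.im - g.im * d.re ≠ 0) :
    0 < ((u 1).re * (z 1).im - (u 1).im * (z 1).re) * (g.re * d.im - g.im * d.re) := by
  have hpi := Real.pi_pos
  have hu1 := hu 1 one_pos (by omega)
  have hum' := hu m hm1 (by omega)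
  have hstep : ∀ j, j + 1 < m + 1 → Wd z (k + 1) (u (j + 1)) = Wd z (k + 1) (u 1) := by
    intro j
    induction j with
    | zero => intro _; rfl
    | succ j ih =>
      intro hj
      rw [← ih (by omega)]
      have hsub : segment ℝ (u (j + 1)) (u (j + 1 + 1)) ⊆ HReg β :=
        (HReg_convex β).segment_subset (hu _ (by omega) (by omega)) (hu _ (by omega) (by omega))
      refine Wd_const β z (k + 1) (by omega) hz0 hzk (segment ℝ (u (j + 1)) (u (j + 1 + 1)))
        (convex_segment _ _) hsub ?_ (right_mem_segment ℝ _ _) (left_mem_segment ℝ _ _)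
      intro x hx i hi hxi
      exact hdis i hi (j + 1) (by omega) x (hsub hx) hxi hx
  have hmeq : Wd z (k + 1) (u m) = Wd z (k + 1) (u 1) := by
    obtain ⟨m', rfl⟩ : ∃ m', m = m' + 1 := ⟨m - 1, by omega⟩
    exact hstep m' (by omega)
  have hE0 : ∀ ε : ℝ, 0 < ε → ε ≤ 1 → Wd z (k + 1) (ε * u 1) = Wd z (k + 1) (u 1) := by
    intro ε h1 h2
    refine Wd_const β z (k + 1) (by omega) hz0 hzk (segment ℝ (u 0) (u 1) ∩ HReg β)
      ((convex_segment _ _).inter (HReg_convex β)) Set.inter_subset_right ?_ ?_ ?_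
    · intro x hx i hi hxi
      exact hdis i hi 0 (by omega) x hx.2 hxi hx.1
    · refine ⟨⟨1 - ε, ε, by linarith, h1.le, by ring, ?_⟩, HReg_zero hu1 h1 h2⟩
      rw [hu0]; simp
    · exact ⟨right_mem_segment ℝ _ _, hu1⟩
  have hE1 : ∀ ε : ℝ, 0 < ε → ε ≤ 1 → Wd z (k + 1) (β + ε * d) = Wd z (k + 1) (u 1) := by
    intro ε h1 h2
    rw [← hmeq]
    refine Wd_const β z (k + 1) (by omega) hz0 hzk (segment ℝ (u m) (u (m + 1)) ∩ HReg β)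
      ((convex_segment _ _).inter (HReg_convex β)) Set.inter_subset_right ?_ ?_ ?_
    · intro x hx i hi hxi
      exact hdis i hi m (by omega) x hx.2 hxi hx.1
    · refine ⟨⟨ε, 1 - ε, h1.le, by linarith, by ring, ?_⟩, ?_⟩
      · rw [hum, hd]; simp; ring
      · rw [hd]; exact HReg_beta hum' h1 h2
    · exact ⟨left_mem_segment ℝ _ _, hum'⟩
  have r0 := Wd_at_zero β hβ z k hz0 hzk hz hk1 (u 1) hu1 _ hE0 hA
  have r1 := Wd_at_beta β hβ z k hz0 hzk hz hk1 d g (by rw [hd]; simpa using hum') hg _ hE1 hB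
  rcases lt_or_gt_of_ne hA with h1 | h1 <;> rcases lt_or_gt_of_ne hB with h2 | h2
  · exact mul_pos_of_neg_of_neg h1 h2
  · have e1 := r0.2 h1
    have e2 := r1.1 h2
    linarith
  · have e1 := r0.1 h1
    have e2 := r1.2 h2
    linarith
  · exact mul_pos h1 h2

section
variable {V : Type*} [NormedAddCommGroup V] [InnerProductSpace ℝ V]

open InnerProductGeometry in
lemma inner_sum_pos {x y z : V} (hx : x ≠ 0) (hy : y ≠ 0) (hz : z ≠ 0)
    (h : angle x z + angle z y < Real.pi) : 0 < ⟪‖x‖⁻¹ • x + ‖y‖⁻¹ • y, z⟫ := by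
  have hx' : 0 < ‖x‖ := norm_pos_iff.2 hx
  have hy' : 0 < ‖y‖ := norm_pos_iff.2 hy
  have hz' : 0 < ‖z‖ := norm_pos_iff.2 hz
  rw [inner_add_left, real_inner_smul_left, real_inner_smul_left]
  rw [← cos_angle_mul_norm_mul_norm x z, ← cos_angle_mul_norm_mul_norm y z, angle_comm y z]
  have : Real.cos (Real.pi - angle z y) < Real.cos (angle x z) :=
    Real.cos_lt_cos_of_nonneg_of_le_pi (angle_nonneg _ _) (by linarith [angle_nonneg z y])
      (by linarith)
  rw [Real.cos_pi_sub] at this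
  have e : ‖x‖⁻¹ * (Real.cos (angle x z) * (‖x‖ * ‖z‖)) +
      ‖y‖⁻¹ * (Real.cos (angle z y) * (‖y‖ * ‖z‖)) =
      (Real.cos (angle x z) + Real.cos (angle z y)) * ‖z‖ := by
    field_simp
  rw [e]
  exact mul_pos (by linarith) hz'

open InnerProductGeometry in
/-- A closed spherical polygon of length less than `2π` lies in an open hemisphere. -/
lemma hemisphere (f : ℕ → V) (n : ℕ) (hn : 0 < n) (hclose : f n = f 0) 
    (hli : ∀ i < n, LinearIndependent ℝ ![f i, f (i + 1)])
    (hL : ∑ i ∈ Finset.range n, angle (f i) (f (i + 1)) < 2 * Real.pi) :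
    ∃ h : V, ∀ i < n, 0 < ⟪h, f i⟫ := by
  set S : ℕ → ℝ := fun j => ∑ i ∈ Finset.range j, angle (f i) (f (i + 1)) with hS
  have hS0 : S 0 = 0 := by simp [hS]
  have hSs : ∀ j, S (j + 1) = S j + angle (f j) (f (j + 1)) := fun j => by
    simp [hS, Finset.sum_range_succ]
  have hne : ∀ i < n, f i ≠ 0 := fun i hi => (hli i hi).ne_zero 0
  have hne' : ∀ i ≤ n, f i ≠ 0 := by
    intro i hi
    rcases hi.eq_or_lt with rfl | hi
    · rw [hclose]; exact hne 0 hn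
    · exact hne i hi
  have hang : ∀ i j, i + j ≤ n → angle (f i) (f (i + j)) ≤ S (i + j) - S i := by
    intro i j
    induction j with
    | zero => intro h; simp [angle_self (hne' i h)]
    | succ j ih =>
      intro h
      have h1 := ih (by omega)
      have h2 := angle_le_angle_add_angle (f i) (f (i + j)) (f (i + j + 1))
      have h3 := hSs (i + j)
      rw [← add_assoc]
      linarith
  have hang' : ∀ i j, i ≤ j → j ≤ n → angle (f i) (f j) ≤ S j - S i := by
    intro i j hij hj
    obtain ⟨l, rfl⟩ := Nat.exists_eq_add_of_le hij
    exact hang i l hj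
  have hLpi : S n < 2 * Real.pi := hL
  have hLnn : 0 ≤ S n := Finset.sum_nonneg fun i _ => angle_nonneg _ _
  obtain ⟨k, hkn, hk1, hk2⟩ : ∃ k < n, S k ≤ S n / 2 ∧ S n / 2 ≤ S (k + 1) := by
    have hex : ∃ k, S n / 2 ≤ S (k + 1) := ⟨n - 1, by
      rw [Nat.sub_add_cancel hn]; linarith⟩
    classical
    refine ⟨Nat.find hex, ?_, ?_, Nat.find_spec hex⟩
    · have : Nat.find hex ≤ n - 1 := Nat.find_min' hex (by rw [Nat.sub_add_cancel hn]; linarith)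
      omega
    · rcases Nat.eq_zero_or_pos (Nat.find hex) with h | h
      · rw [h, hS0]; linarith
      · have := Nat.find_min hex (m := Nat.find hex - 1) (by omega)
        rw [Nat.sub_add_cancel h] at this
        linarith
  have hyne : ∀ t : ℝ, (1 - t) • f k + t • f (k + 1) ≠ 0 := by
    intro t ht
    have := LinearIndependent.pair_iff.1 (hli k hkn) _ _ ht
    linarith [this.1, this.2]
  have hfk := hne k hkn
  have hfk1 := hne' (k + 1) hkn
  have hcont : Continuous fun t : ℝ => S k + angle (f k) ((1 - t) • f k + t • f (k + 1)) := by
    rw [continuous_iff_continuousAt]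
    intro t
    apply ContinuousAt.add continuousAt_const
    exact (continuousAt_angle (x := (f k, (1 - t) • f k + t • f (k + 1))) hfk (hyne t)).comp
      (f := fun t : ℝ => (f k, (1 - t) • f k + t • f (k + 1))) (by fun_prop)
  obtain ⟨t, ⟨ht0, ht1⟩, ht⟩ : S n / 2 ∈ (fun t : ℝ => S k + angle (f k) ((1 - t) • f k + t • f (k + 1))) '' Set.Icc 0 1 := by
    apply intermediate_value_Icc zero_le_one hcont.continuousOn
    simp only [sub_zero, one_smul, zero_smul, add_zero, sub_self, zero_add]
    rw [angle_self hfk, ← hSs k]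
    exact ⟨by simpa using hk1, hk2⟩
  simp only at ht
  set y := (1 - t) • f k + t • f (k + 1) with hy
  have hy0 : y ≠ 0 := hyne t
  have hadd : angle (f k) (f (k + 1)) = angle (f k) y + angle y (f (k + 1)) := by
    apply angle_eq_angle_add_add_angle_add_of_mem_span hy0
    rw [Submodule.mem_span_pair]
    exact ⟨⟨1 - t, by linarith⟩, ⟨t, ht0⟩, rfl⟩
  have hsk := hSs k
  refine ⟨‖f 0‖⁻¹ • f 0 + ‖y‖⁻¹ • y, fun j hj => ?_⟩
  apply inner_sum_pos (hne 0 hn) hy0 (hne j hj)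
  rcases le_or_gt j k with hjk | hjk
  · have h1 := hang' 0 j (by omega) (by omega)
    have h2 := hang' j k hjk (by omega)
    have h3 := angle_le_angle_add_angle (f j) (f k) y
    linarith
  · have h1 := hang' (k + 1) j hjk (by omega)
    have h2 := hang' j n (by omega) le_rfl
    rw [hclose] at h2
    have h3 := angle_le_angle_add_angle y (f (k + 1)) (f j)
    rw [angle_comm (f 0), angle_comm (f j) y]
    linarith
end


/-! ### Vector algebra -/

lemma inner3 (x y : E3) : ⟪x, y⟫ = x 0 * y 0 + x 1 * y 1 + x 2 * y 2 := by
  simp [PiLp.inner_apply, Fin.sum_univ_three, mul_comm]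

lemma cross3_0 (a b : E3) : cross3 a b 0 = a 1 * b 2 - a 2 * b 1 := by simp [cross3]
lemma cross3_1 (a b : E3) : cross3 a b 1 = a 2 * b 0 - a 0 * b 2 := by simp [cross3]
lemma cross3_2 (a b : E3) : cross3 a b 2 = a 0 * b 1 - a 1 * b 0 := by simp [cross3]

/-- The determinant of three vectors. -/
def det3 (a b c : E3) : ℝ := ⟪cross3 a b, c⟫

lemma E3_ext {x y : E3} (h0 : x 0 = y 0) (h1 : x 1 = y 1) (h2 : x 2 = y 2) : x = y := by
  ext i; fin_cases i <;> assumption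

lemma dual_expansion (a b c N : E3) :
    det3 a b c • N = ⟪N, c⟫ • cross3 a b + ⟪N, a⟫ • cross3 b c + ⟪N, b⟫ • cross3 c a := by
  unfold det3
  apply E3_ext <;>
  · simp only [inner3, PiLp.add_apply, PiLp.smul_apply, smul_eq_mul, cross3_0, cross3_1, cross3_2]
    ring

lemma cross3_cross3 (a b c : E3) : cross3 (cross3 a b) (cross3 b c) = det3 a b c • b := by
  unfold det3
  apply E3_ext <;>
  · simp only [inner3, PiLp.smul_apply, smul_eq_mul, cross3_0, cross3_1, cross3_2]
    ring

lemma cross_smul (s t : ℝ) (a b : E3) : cross3 (s • a) (t • b) = (s * t) • cross3 a b := by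
  apply E3_ext <;>
  · simp only [PiLp.smul_apply, smul_eq_mul, cross3_0, cross3_1, cross3_2]
    ring

lemma det_mul (a b c M N h : E3) : det3 a b c * det3 M N h =
    ⟪M, a⟫ * (⟪N, b⟫ * ⟪h, c⟫ - ⟪h, b⟫ * ⟪N, c⟫) - ⟪N, a⟫ * (⟪M, b⟫ * ⟪h, c⟫ - ⟪h, b⟫ * ⟪M, c⟫)
      + ⟪h, a⟫ * (⟪M, b⟫ * ⟪N, c⟫ - ⟪N, b⟫ * ⟪M, c⟫) := by
  unfold det3
  simp only [inner3, cross3_0, cross3_1, cross3_2]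
  ring

lemma cross_norm (a b : E3) : ⟪cross3 a b, cross3 a b⟫ = ⟪a, a⟫ * ⟪b, b⟫ - ⟪a, b⟫ ^ 2 := by
  simp only [inner3, cross3_0, cross3_1, cross3_2]
  ring

lemma det3_perm (a b c : E3) : ⟪cross3 b c, a⟫ = det3 a b c := by
  unfold det3
  simp only [inner3, cross3_0, cross3_1, cross3_2]
  ring

lemma inner_cross_left (a b : E3) : ⟪cross3 a b, a⟫ = 0 := by
  simp only [inner3, cross3_0, cross3_1, cross3_2]
  ring

lemma inner_cross_right (a b : E3) : ⟪cross3 a b, b⟫ = 0 := by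
  simp only [inner3, cross3_0, cross3_1, cross3_2]
  ring

/-- Three independent functionals determine a vector. -/
lemma eq_of_inner {M N h x y : E3} (hd : det3 M N h ≠ 0) (h1 : ⟪M, x⟫ = ⟪M, y⟫)
    (h2 : ⟪N, x⟫ = ⟪N, y⟫) (h3 : ⟪h, x⟫ = ⟪h, y⟫) : x = y := by
  have := dual_expansion M N h (x - y)
  rw [real_inner_comm, real_inner_comm M, real_inner_comm N, inner_sub_right, inner_sub_right,
    inner_sub_right, h1, h2, h3] at this
  simp only [sub_self, zero_smul, add_zero] at this
  rcases smul_eq_zero.1 this with h | h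
  · exact absurd h hd
  · exact sub_eq_zero.1 h

/-- Linear independence gives a nonzero cross product. -/
lemma cross_ne_zero {a b : E3} (h : LinearIndependent ℝ ![a, b]) : cross3 a b ≠ 0 := by
  intro h0
  have h1 := cross_norm a b
  rw [h0, inner_zero_left] at h1
  have ha : a ≠ 0 := h.ne_zero 0
  have haa : ⟪a, a⟫ ≠ 0 := inner_self_ne_zero.2 ha
  have h2 : ⟪a, b⟫ • a + (-⟪a, a⟫) • b = 0 := by
    rw [← inner_self_eq_zero (𝕜 := ℝ)]
    simp only [inner_add_left, inner_add_right, real_inner_smul_left, real_inner_smul_right,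
      real_inner_comm a b] at h1 ⊢
    linear_combination (-⟪a, a⟫) * h1
  have := LinearIndependent.pair_iff.1 h _ _ h2
  exact haa (by linarith [this.2])

/-- Consecutive normals are not parallel, hence the determinants do not vanish. -/
lemma det_ne_zero {a b c : E3} (h1 : cross3 a b ≠ 0) (h2 : cross3 b c ≠ 0)
    (h3 : ‖cross3 b c‖⁻¹ • cross3 b c ≠ ‖cross3 a b‖⁻¹ • cross3 a b)
    (h4 : ‖cross3 b c‖⁻¹ • cross3 b c ≠ -(‖cross3 a b‖⁻¹ • cross3 a b)) : det3 a b c ≠ 0 := by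
  intro h0
  set p := ‖cross3 a b‖⁻¹ • cross3 a b with hp
  set q := ‖cross3 b c‖⁻¹ • cross3 b c with hq
  have hpn : ‖p‖ = 1 := norm_smul_inv_norm (𝕜 := ℝ) h1
  have hqn : ‖q‖ = 1 := norm_smul_inv_norm (𝕜 := ℝ) h2
  have hc : cross3 p q = 0 := by
    rw [hp, hq, cross_smul, cross3_cross3, h0]; simp
  have := cross_norm p q
  rw [hc, inner_zero_left, real_inner_self_eq_norm_sq, real_inner_self_eq_norm_sq, hpn, hqn] at this
  have h5 : (⟪p, q⟫ - 1) * (⟪p, q⟫ + 1) = 0 := by linarith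
  rcases mul_eq_zero.1 h5 with h | h
  · exact h3 ((inner_eq_one_iff_of_norm_eq_one (𝕜 := ℝ) hpn hqn).1 (by linarith)).symm
  · have : ⟪p, -q⟫ = 1 := by rw [inner_neg_right]; linarith
    have := (inner_eq_one_iff_of_norm_eq_one hpn (by rwa [norm_neg])).1 this
    exact h4 (by rw [this]; simp)

/-! ### Cones over the faces -/

lemma mem_face (v p q : E3) {s t : ℝ} (hs : 0 ≤ s) (ht : 0 ≤ t) (hst : s + t ≤ 1) :
    v + (s • (p - v) + t • (q - v)) ∈ convexHull ℝ {v, p, q} := by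
  have hv : v ∈ convexHull ℝ {v, p, q} := subset_convexHull ℝ _ (by simp)
  have hp : p ∈ convexHull ℝ {v, p, q} := subset_convexHull ℝ _ (by simp)
  have hq : q ∈ convexHull ℝ {v, p, q} := subset_convexHull ℝ _ (by simp)
  have := (convex_convexHull ℝ {v, p, q}).sum_mem (t := Finset.univ) (w := ![1 - s - t, s, t])
    (z := ![v, p, q]) (by intro i _; fin_cases i <;> simp <;> linarith)
    (by simp [Fin.sum_univ_three]; ring)
    (by intro i _; fin_cases i <;> simp <;> assumption)
  convert this using 1
  simp [Fin.sum_univ_three]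
  module

lemma cone_scale {s t s' t' : ℝ} (hs : 0 ≤ s) (ht : 0 ≤ t) (hs' : 0 ≤ s') (ht' : 0 ≤ t') :
    ∃ l : ℝ, 0 < l ∧ l * s + l * t ≤ 1 ∧ l * s' + l * t' ≤ 1 := by
  refine ⟨(1 + s + t + s' + t')⁻¹, by positivity, ?_, ?_⟩
  · rw [← mul_add, inv_mul_le_iff₀ (by positivity)]; linarith
  · rw [← mul_add, inv_mul_le_iff₀ (by positivity)]; linarith

lemma cone_nonadj {n : ℕ} {v : E3} {w : ZMod n → E3} (hstar : IsStar v w) {i j : ZMod n}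
    (hij : i ≠ j) (h1 : j ≠ i + 1) (h2 : i ≠ j + 1) {s t s' t' : ℝ} (hs : 0 ≤ s) (ht : 0 ≤ t)
    (hs' : 0 ≤ s') (ht' : 0 ≤ t')
    (h : s • (w i - v) + t • (w (i + 1) - v) = s' • (w j - v) + t' • (w (j + 1) - v)) :
    s • (w i - v) + t • (w (i + 1) - v) = 0 := by
  obtain ⟨l, hl, hl1, hl2⟩ := cone_scale hs ht hs' ht'
  have hI := ((hstar.2.2.2 i j hij).2.2 h1 h2)
  have m1 := mem_face v (w i) (w (i + 1)) (mul_nonneg hl.le hs) (mul_nonneg hl.le ht) hl1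
  have m2 := mem_face v (w j) (w (j + 1)) (mul_nonneg hl.le hs') (mul_nonneg hl.le ht') hl2
  simp only [mul_smul, ← smul_add] at m1 m2
  rw [← h] at m2
  have : v + l • (s • (w i - v) + t • (w (i + 1) - v)) ∈ starFace v w i ∩ starFace v w j :=
    ⟨m1, m2⟩
  rw [hI, Set.mem_singleton_iff, add_eq_left] at this
  exact (smul_eq_zero.1 this).resolve_left hl.ne'

lemma cone_adj {n : ℕ} {v : E3} {w : ZMod n → E3} (hstar : IsStar v w) {i : ZMod n}
    (hij : i ≠ i + 1) {s t s' t' : ℝ} (hs : 0 ≤ s) (ht : 0 ≤ t)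
    (hs' : 0 ≤ s') (ht' : 0 ≤ t')
    (h : s • (w i - v) + t • (w (i + 1) - v) = s' • (w (i + 1) - v) + t' • (w (i + 1 + 1) - v)) :
    ∃ r : ℝ, s • (w i - v) + t • (w (i + 1) - v) = r • (w (i + 1) - v) := by
  obtain ⟨l, hl, hl1, hl2⟩ := cone_scale hs ht hs' ht'
  have hI := ((hstar.2.2.2 i (i + 1) hij).1 rfl)
  have m1 := mem_face v (w i) (w (i + 1)) (mul_nonneg hl.le hs) (mul_nonneg hl.le ht) hl1
  have m2 := mem_face v (w (i + 1)) (w (i + 1 + 1)) (mul_nonneg hl.le hs') (mul_nonneg hl.le ht') hl2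
  simp only [mul_smul, ← smul_add] at m1 m2
  rw [← h] at m2
  have : v + l • (s • (w i - v) + t • (w (i + 1) - v)) ∈ starFace v w i ∩ starFace v w (i + 1) :=
    ⟨m1, m2⟩
  rw [hI, segment_eq_image'] at this
  obtain ⟨θ, _, hθ⟩ := this
  refine ⟨l⁻¹ * θ, ?_⟩
  have := add_left_cancel hθ
  rw [mul_smul, this, inv_smul_smul₀ hl.ne']


/-! ### The planar picture of the star -/

/-- Central projection to the plane, in coordinates `M / h`, `N / h`. -/
def proj (M N h x : E3) : ℂ := ⟨⟪M, x⟫ / ⟪h, x⟫, ⟪N, x⟫ / ⟪h, x⟫⟩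

lemma seg_lift {M N h p q : E3} (hp : 0 < ⟪h, p⟫) (hq : 0 < ⟪h, q⟫) {x : ℂ}
    (hx : x ∈ segment ℝ (proj M N h p) (proj M N h q)) :
    ∃ s t : ℝ, 0 ≤ s ∧ 0 ≤ t ∧ ⟪M, s • p + t • q⟫ = x.re ∧ ⟪N, s • p + t • q⟫ = x.im ∧
      ⟪h, s • p + t • q⟫ = 1 := by
  obtain ⟨a, b, ha, hb, hab, rfl⟩ := hx
  refine ⟨a / ⟪h, p⟫, b / ⟪h, q⟫, by positivity, by positivity, ?_, ?_, ?_⟩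
  · simp [inner_add_right, real_inner_smul_right, proj]; ring
  · simp [inner_add_right, real_inner_smul_right, proj]; ring
  · simp only [inner_add_right, real_inner_smul_right]
    rw [div_mul_cancel₀ _ hp.ne', div_mul_cancel₀ _ hq.ne', hab]

lemma cast_ne_zero_of_lt {n i : ℕ} (h0 : 0 < i) (h1 : i < n) : (i : ZMod n) ≠ 0 := by
  intro h
  rw [ZMod.natCast_eq_zero_iff] at h
  exact absurd (Nat.le_of_dvd h0 h) (by omega)

lemma jordan3 {n : ℕ} [NeZero n] {v : E3} {w : ZMod n → E3} (hstar : IsStar v w)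
    (e : ZMod n → E3) (he : ∀ i, e i = w i - v) (h M N : E3) (a b : ZMod n)
    (hh : ∀ i, 0 < ⟪h, e i⟫) (hMa : ⟪M, e a⟫ = 0) (hM : ∀ i, i ≠ a → 0 < ⟪M, e i⟫)
    (hN : ∀ i, 0 ≤ ⟪N, e i⟫) (hNa : ⟪N, e a⟫ = 0) (hNb : ⟪N, e b⟫ = 0)
    (hdet : det3 M N h ≠ 0)
    (hfar : ∀ i, i ≠ b → ⟪N, e i⟫ = 0 → ⟪M, e i⟫ / ⟪h, e i⟫ < ⟪M, e b⟫ / ⟪h, e b⟫)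
    (hab : b ≠ a) (hab1 : b ≠ a + 1) (hab2 : a ≠ b + 1)
    (hD : ∀ i, det3 (e (i - 1)) (e i) (e (i + 1)) ≠ 0) :
    0 < det3 (e (a - 1)) (e a) (e (a + 1)) * det3 (e (b - 1)) (e b) (e (b + 1)) := by
  have hn : 3 ≤ n := hstar.1
  have h10 : (1 : ZMod n) ≠ 0 := by
    have := cast_ne_zero_of_lt (n := n) (i := 1) one_pos (by omega)
    simpa using this
  set β : ℝ := ⟪M, e b⟫ / ⟪h, e b⟫ with hβdef
  have hβ : 0 < β := div_pos (hM b hab) (hh b)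
  -- the number of steps from `a` to `b`
  obtain ⟨k, hkval⟩ : ∃ k : ℕ, (b - a).val = k + 1 := by
    refine ⟨(b - a).val - 1, ?_⟩
    have : (b - a).val ≠ 0 := by
      rw [Ne, ZMod.val_eq_zero]; exact sub_ne_zero.2 hab
    omega
  have hkb : a + ((k + 1 : ℕ) : ZMod n) = b := by
    rw [← hkval, ZMod.natCast_val, ZMod.cast_id]; ring
  have hklt : k + 1 < n := hkval ▸ ZMod.val_lt _
  obtain ⟨m, hm⟩ : ∃ m, n = k + m + 2 := ⟨n - (k + 2), by omega⟩
  have hk0 : 0 < k := by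
    rcases Nat.eq_zero_or_pos k with h0 | h0
    · subst h0; exact absurd hkb.symm (by simpa using hab1)
    · exact h0
  have hncast : ((k + m + 2 : ℕ) : ZMod n) = 0 := by rw [← hm]; simp
  have hm0 : 0 < m := by
    rcases Nat.eq_zero_or_pos m with h0 | h0
    · subst h0
      exfalso; apply hab2
      rw [← hkb]
      push_cast at hncast ⊢
      linear_combination -hncast
    · exact h0
  have hmb : a - ((m + 1 : ℕ) : ZMod n) = b := by
    rw [← hkb]
    push_cast at hncast ⊢
    linear_combination -hncast
  have hreg : ∀ c, c ≠ a → c ≠ b → proj M N h (e c) ∈ HReg β := by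
    intro c h1 h2
    rcases (hN c).eq_or_lt with h0 | h0
    · right
      refine ⟨by simp [proj, ← h0], div_pos (hM c h1) (hh c), hfar c h2 h0.symm⟩
    · left
      exact div_pos h0 (hh c)
  have hpb : proj M N h (e b) = β := by
    apply Complex.ext
    · simp [proj, hβdef]
    · simp [proj, hNb]
  have hpa : proj M N h (e a) = 0 := by
    apply Complex.ext
    · simp [proj, hMa]
    · simp [proj, hNa]
  have key := planar_order β hβ (fun i => proj M N h (e (a + (i : ℕ))))
    (fun j => proj M N h (e (a - (j : ℕ)))) k m hk0 hm0 (by simpa using hpa)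
    (by simp only [hkb, hpb]) ?_ (by simpa using hpa) (by simp only [hmb, hpb]) ?_ ?_
    (proj M N h (e (b - 1)) - β) (proj M N h (e (b + 1)) - β) ?_ ?_
  rotate_left
  · intro i hi0 hi1
    apply hreg
    · have := cast_ne_zero_of_lt (n := n) hi0 (by omega)
      simpa using this
    · rw [← hkb]
      intro hc
      have h1 := cast_ne_zero_of_lt (n := n) (i := k + 1 - i) (by omega) (by omega)
      apply h1
      rw [Nat.cast_sub hi1.le]
      linear_combination -hc
  · intro i hi0 hi1
    apply hreg
    · have := cast_ne_zero_of_lt (n := n) hi0 (by omega)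
      simpa using this
    · rw [← hmb]
      intro hc
      have h1 := cast_ne_zero_of_lt (n := n) (i := m + 1 - i) (by omega) (by omega)
      apply h1
      rw [Nat.cast_sub hi1.le]
      linear_combination hc
  · intro i hi j hj x hxH hx1 hx2
    obtain ⟨s, t, hs, ht, e1, e2, e3⟩ := seg_lift (hh _) (hh _) hx1
    obtain ⟨t', s', ht', hs', f1, f2, f3⟩ := seg_lift (hh _) (hh _) hx2
    have heq := eq_of_inner hdet (e1.trans f1.symm) (e2.trans f2.symm) (e3.trans f3.symm)
    set c : ZMod n := a + (i : ℕ) with hc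
    set c' : ZMod n := a - ((j + 1 : ℕ) : ZMod n) with hc'
    have hc1 : a + ((i + 1 : ℕ) : ZMod n) = c + 1 := by rw [hc]; push_cast; ring
    have hc'1 : a - (j : ZMod n) = c' + 1 := by rw [hc']; push_cast; ring
    rw [hc1] at heq e1 e2 e3
    rw [hc'1] at heq
    have hcc : c ≠ c' := by
      intro hcc
      apply cast_ne_zero_of_lt (n := n) (i := i + j + 1) (by omega) (by omega)
      rw [hc, hc'] at hcc
      push_cast at hcc ⊢
      linear_combination hcc
    rw [add_comm (t' • _)] at heq
    by_cases hA : c' = c + 1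
    · have hidx : i + j + 2 = n := by
        by_contra hne
        apply cast_ne_zero_of_lt (n := n) (i := i + j + 2) (by omega) (by omega)
        rw [hc, hc'] at hA
        push_cast at hA ⊢
        linear_combination -hA
      have hik : i = k := by omega
      have hcb : c + 1 = b := by rw [← hc1, hik, hkb]
      rw [hA] at heq
      obtain ⟨r, hr⟩ := cone_adj (i := c) hstar (by simpa using h10) hs ht hs' ht'
        (by simpa only [he] using heq)
      rw [← he, ← he, hcb] at hr
      rw [hcb] at e1 e2 e3
      rw [hr, real_inner_smul_right] at e1 e2 e3
      apply HReg_ne_beta hxH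
      have hhb := (hh b).ne'
      apply Complex.ext
      · rw [← e1, Complex.ofReal_re, hβdef, eq_div_iff hhb]
        linear_combination ⟪M, e b⟫ * e3
      · rw [← e2, hNb]; simp
    by_cases hB : c = c' + 1
    · have hidx : i + j = 0 := by
        by_contra hne
        apply cast_ne_zero_of_lt (n := n) (i := i + j) (by omega) (by omega)
        rw [hc, hc'] at hB
        push_cast at hB ⊢
        linear_combination hB
      have hi0 : i = 0 := by omega
      have hca : c = a := by rw [hc, hi0]; simp
      have heq' := heq.symm
      rw [hB] at heq'
      obtain ⟨r, hr⟩ := cone_adj (i := c') hstar (by simpa using h10) hs' ht' hs ht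
        (by simpa only [he] using heq')
      rw [← he, ← he, ← hB, hca] at hr
      rw [heq, ← hB, hca, hr, real_inner_smul_right] at e1 e2
      apply HReg_ne_zero hxH
      apply Complex.ext
      · rw [← e1, hMa]; simp
      · rw [← e2, hNa]; simp
    have := cone_nonadj hstar hcc hA hB hs ht hs' ht' (by simpa only [he] using heq)
    rw [← he, ← he] at this
    rw [this, inner_zero_right] at e3
    exact zero_ne_one e3
  · congr 3
    rw [← hkb]; push_cast; ring
  · congr 3
    rw [← hmb]; push_cast; ring
  -- orientation at `a`
  have oa : det3 (e (a - 1)) (e a) (e (a + 1)) * det3 M N h =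
      -(⟪h, e (a - 1)⟫ * ⟪h, e a⟫ * ⟪h, e (a + 1)⟫) *
      ((proj M N h (e (a - 1))).re * (proj M N h (e (a + 1))).im -
        (proj M N h (e (a - 1))).im * (proj M N h (e (a + 1))).re) := by
    have i1 := (hh (a - 1)).ne'
    have i2 := (hh (a + 1)).ne'
    rw [det_mul, hMa, hNa]
    simp only [proj]
    field_simp
    ring
  have ob : det3 (e (b - 1)) (e b) (e (b + 1)) * det3 M N h =
      -(⟪h, e (b - 1)⟫ * ⟪h, e b⟫ * ⟪h, e (b + 1)⟫) *
      ((proj M N h (e (b - 1)) - β).re * (proj M N h (e (b + 1)) - β).im -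
        (proj M N h (e (b - 1)) - β).im * (proj M N h (e (b + 1)) - β).re) := by
    have i1 := (hh (b - 1)).ne'
    have i2 := (hh (b + 1)).ne'
    have i3 := (hh b).ne'
    rw [det_mul, hNb]
    simp only [proj, Complex.sub_re, Complex.sub_im, Complex.ofReal_re, Complex.ofReal_im, hβdef]
    field_simp
    ring
  have pa : 0 < ⟪h, e (a - 1)⟫ * ⟪h, e a⟫ * ⟪h, e (a + 1)⟫ :=
    mul_pos (mul_pos (hh _) (hh _)) (hh _)
  have pb : 0 < ⟪h, e (b - 1)⟫ * ⟪h, e b⟫ * ⟪h, e (b + 1)⟫ :=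
    mul_pos (mul_pos (hh _) (hh _)) (hh _)
  simp only [Nat.cast_one] at key
  have key2 := key ?_ ?_
  · have hmul := congrArg₂ (· * ·) oa ob
    have : 0 < (det3 (e (a - 1)) (e a) (e (a + 1)) * det3 (e (b - 1)) (e b) (e (b + 1))) *
        (det3 M N h) ^ 2 := by
      have h1 := mul_pos (mul_pos pa pb) key2
      refine lt_of_lt_of_eq h1 ?_
      linear_combination -hmul
    exact pos_of_mul_pos_left this (sq_nonneg _)
  · intro h0
    rw [h0, mul_zero] at oa
    exact mul_ne_zero (hD a) hdet oa
  · intro h0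
    rw [h0, mul_zero] at ob
    exact mul_ne_zero (hD b) hdet ob


/-! ### Exposed rays and the propagation step -/

/-- The ray through `e a` is an exposed ray of the cone generated by all `e i`. -/
def Exposed {n : ℕ} (e : ZMod n → E3) (a : ZMod n) : Prop :=
  ∃ M : E3, ⟪M, e a⟫ = 0 ∧ ∀ i, i ≠ a → 0 < ⟪M, e i⟫

lemma ray_inj {n : ℕ} {v : E3} {w : ZMod n → E3} (hstar : IsStar v w)
    (e : ZMod n → E3) (he : ∀ i, e i = w i - v) {i j : ZMod n} (hij : i ≠ j) {r : ℝ} (hr : 0 < r)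
    (h : e i = r • e j) : False := by
  have hli := hstar.2.1
  simp only [← he] at hli
  by_cases h1 : j = i + 1
  · have h2 : (1 : ℝ) • e i + (-r) • e (i + 1) = 0 := by rw [h, ← h1]; module
    exact one_ne_zero (LinearIndependent.pair_iff.1 (hli i) _ _ h2).1
  by_cases h2 : i = j + 1
  · have h2 : (-r) • e j + (1 : ℝ) • e (j + 1) = 0 := by rw [← h2, h]; module
    exact one_ne_zero (LinearIndependent.pair_iff.1 (hli j) _ _ h2).2
  have := cone_nonadj hstar hij h1 h2 (s := 1) (t := 0) (s' := r) (t' := 0) zero_le_one le_rfl hr.le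
    le_rfl (by rw [← he i, ← he j, h]; simp)
  rw [← he, zero_smul, add_zero, one_smul] at this
  exact (hli i).ne_zero 0 this

open Filter Topology in
lemma exists_eps {ι : Type*} [Finite ι] (A B : ι → ℝ) (P : ι → Prop)
    (h : ∀ i, P i → 0 < A i ∨ (A i = 0 ∧ 0 < B i)) :
    ∃ ε : ℝ, 0 < ε ∧ ∀ i, P i → 0 < A i + ε * B i := by
  have h1 : ∀ᶠ ε in 𝓝[>] (0 : ℝ), ∀ i, P i → 0 < A i + ε * B i := by
    rw [eventually_all]
    intro i
    by_cases hP : P i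
    · rcases h i hP with h0 | ⟨h0, h1⟩
      · have hc : ContinuousAt (fun ε : ℝ => A i + ε * B i) 0 := by fun_prop
        have : ∀ᶠ ε in 𝓝 (0 : ℝ), 0 < A i + ε * B i :=
          hc.eventually (lt_mem_nhds (by simpa using h0))
        filter_upwards [this.filter_mono nhdsWithin_le_nhds] with ε hε _ using hε
      · filter_upwards [self_mem_nhdsWithin] with ε hε _
        rw [h0, zero_add]; exact mul_pos hε h1
    · exact Eventually.of_forall fun ε h => absurd h hP
  obtain ⟨ε, h2, h3⟩ := (h1.and self_mem_nhdsWithin).exists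
  exact ⟨ε, h3, h2⟩

/-- A nonnegative combination of consecutive normals lies on the Gauss arc. -/
lemma arc_mem {n : ℕ} {v : E3} {w : ZMod n → E3} (e : ZMod n → E3) (he : ∀ i, e i = w i - v)
    (hcr : ∀ i, cross3 (e i) (e (i + 1)) ≠ 0) (N : E3) (hN0 : N ≠ 0) (a : ZMod n)
    (hN : ∀ i, 0 ≤ ⟪N, e i⟫) (hNa : ⟪N, e a⟫ = 0)
    (hD : det3 (e (a - 1)) (e a) (e (a + 1)) ≠ 0) :
    ‖det3 (e (a - 1)) (e a) (e (a + 1)) • N‖⁻¹ • (det3 (e (a - 1)) (e a) (e (a + 1)) • N) ∈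
      sArc (starUN v w (a - 1)) (starUN v w (a - 1 + 1)) := by
  have hexp := dual_expansion (e (a - 1)) (e a) (e (a + 1)) N
  rw [hNa, zero_smul, add_zero] at hexp
  have hfn : ∀ i, starFN v w i = cross3 (e i) (e (i + 1)) := fun i => by
    rw [starFN, he, he]
  have hpos : ∀ i, 0 < ‖starFN v w i‖ := fun i => by
    rw [hfn]; exact norm_pos_iff.2 (hcr i)
  have hUN : ∀ i, ‖starFN v w i‖ • starUN v w i = cross3 (e i) (e (i + 1)) := fun i => by
    rw [starUN, smul_inv_smul₀ (hpos i).ne', hfn]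
  have h1 := hUN (a - 1)
  have h2 := hUN a
  rw [sub_add_cancel] at h1 ⊢
  rw [← h1, ← h2, smul_smul, smul_smul] at hexp
  have s1 : 0 ≤ ⟪N, e (a + 1)⟫ * ‖starFN v w (a - 1)‖ := mul_nonneg (hN _) (hpos _).le
  have s2 : 0 ≤ ⟪N, e (a - 1)⟫ * ‖starFN v w a‖ := mul_nonneg (hN _) (hpos _).le
  refine ⟨_, _, s1, s2, ?_, by rw [hexp]⟩
  refine lt_of_le_of_ne (add_nonneg s1 s2) ?_
  intro h0
  have z1 : ⟪N, e (a + 1)⟫ * ‖starFN v w (a - 1)‖ = 0 := by linarith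
  have z2 : ⟪N, e (a - 1)⟫ * ‖starFN v w a‖ = 0 := by linarith
  rw [z1, z2, zero_smul, zero_smul, add_zero] at hexp
  exact (smul_ne_zero hD hN0) hexp

lemma normalize_pos_smul (c : ℝ) (hc : 0 < c) (x : E3) : ‖c • x‖⁻¹ • (c • x) = ‖x‖⁻¹ • x := by
  rw [norm_smul, Real.norm_of_nonneg hc.le, smul_smul]
  congr 1
  by_cases h : ‖x‖ = 0
  · simp [h]
  · field_simp

lemma step {n : ℕ} [NeZero n] {v : E3} {w : ZMod n → E3} (hstar : IsStar v w) (hG : GaussEmb v w)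
    (e : ZMod n → E3) (he : ∀ i, e i = w i - v) (h : E3) (hh : ∀ i, 0 < ⟪h, e i⟫)
    (hcr : ∀ i, cross3 (e i) (e (i + 1)) ≠ 0)
    (hD : ∀ i, det3 (e (i - 1)) (e i) (e (i + 1)) ≠ 0) (a : ZMod n) (ha : Exposed e a) :
    (∀ i, 0 ≤ det3 (e (a - 1)) (e a) (e (a + 1)) * ⟪cross3 (e a) (e (a + 1)), e i⟫) ∧
      Exposed e (a + 1) := by
  obtain ⟨M, hMa, hM⟩ := ha
  have hn : 3 ≤ n := hstar.1
  have h10 : (1 : ZMod n) ≠ 0 := by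
    have := cast_ne_zero_of_lt (n := n) (i := 1) one_pos (by omega)
    simpa using this
  have ha1 : a + 1 ≠ a := by simpa using h10
  have ha2 : a - 1 ≠ a := by simpa using h10
  set D := det3 (e (a - 1)) (e a) (e (a + 1)) with hDdef
  obtain ⟨F, hF⟩ : ∃ F : E3, F = D • cross3 (e a) (e (a + 1)) := ⟨_, rfl⟩
  have hFa : ⟪F, e a⟫ = 0 := by rw [hF, real_inner_smul_left, inner_cross_left, mul_zero]
  have hFa1 : ⟪F, e (a + 1)⟫ = 0 := by rw [hF, real_inner_smul_left, inner_cross_right, mul_zero]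
  have hFm : 0 < ⟪F, e (a - 1)⟫ := by
    rw [hF, real_inner_smul_left, det3_perm, ← hDdef]
    exact mul_self_pos.2 (hD a)
  -- rotate the supporting plane
  obtain ⟨c, hc, hcmin⟩ := Finset.exists_min_image (Finset.univ.erase a)
    (fun i => ⟪F, e i⟫ / ⟪M, e i⟫) ⟨a + 1, by simpa using h10⟩
  have hca : c ≠ a := (Finset.mem_erase.1 hc).1
  set t := ⟪F, e c⟫ / ⟪M, e c⟫ with ht
  have ht0 : t ≤ 0 := by
    have := hcmin (a + 1) (by simpa using h10)
    simpa [hFa1] using this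
  obtain ⟨N, hNdef⟩ : ∃ N : E3, N = F - t • M := ⟨_, rfl⟩
  have hNi : ∀ i, ⟪N, e i⟫ = ⟪F, e i⟫ - t * ⟪M, e i⟫ := fun i => by
    rw [hNdef, inner_sub_left, real_inner_smul_left]
  have hNa : ⟪N, e a⟫ = 0 := by rw [hNi, hFa, hMa]; ring
  have hN : ∀ i, 0 ≤ ⟪N, e i⟫ := by
    intro i
    by_cases hi : i = a
    · rw [hi, hNa]
    · have h1 := hcmin i (by simpa using hi)
      rw [hNi]
      have := (le_div_iff₀ (hM i hi)).1 h1
      linarith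
  have hNc : ⟪N, e c⟫ = 0 := by
    rw [hNi, ht, div_mul_cancel₀ _ (hM c hca).ne', sub_self]
  have hNm : 0 < ⟪N, e (a - 1)⟫ := by
    rw [hNi]
    have := hM (a - 1) ha2
    nlinarith
  have hN0 : N ≠ 0 := by
    intro h0
    rw [h0, inner_zero_left] at hNm
    exact lt_irrefl _ hNm
  -- the farthest vertex on the supporting plane
  classical
  obtain ⟨b, hb, hbmax⟩ := Finset.exists_max_image
    (Finset.univ.filter fun i => i ≠ a ∧ ⟪N, e i⟫ = 0)
    (fun i => ⟪M, e i⟫ / ⟪h, e i⟫) ⟨c, by simp [hca, hNc]⟩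
  obtain ⟨hba, hNb⟩ := (Finset.mem_filter.1 hb).2
  have hMb := hM b hba
  have hdet : det3 M N h ≠ 0 := by
    intro h0
    have := det_mul (e a) (e b) (e (a - 1)) M N h
    rw [h0, mul_zero, hMa, hNa, hNb] at this
    have h1 : ⟪h, e a⟫ * (⟪M, e b⟫ * ⟪N, e (a - 1)⟫) = 0 := by linarith
    exact (mul_pos (hh a) (mul_pos hMb hNm)).ne' h1
  have hfar : ∀ i, i ≠ b → ⟪N, e i⟫ = 0 → ⟪M, e i⟫ / ⟪h, e i⟫ < ⟪M, e b⟫ / ⟪h, e b⟫ := by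
    intro i hib hi0
    by_cases hia : i = a
    · rw [hia, hMa, zero_div]; exact div_pos hMb (hh b)
    refine lt_of_le_of_ne (hbmax i (by simp [hia, hi0])) ?_
    intro heq
    have hi' := (hh i).ne'
    have hb' := (hh b).ne'
    refine ray_inj hstar e he hib (r := ⟪h, e i⟫ / ⟪h, e b⟫) (div_pos (hh i) (hh b)) ?_
    apply eq_of_inner hdet
    · rw [real_inner_smul_right]
      field_simp at heq ⊢
      linarith
    · rw [real_inner_smul_right, hi0, hNb, mul_zero]
    · rw [real_inner_smul_right]; field_simp
  -- `b` is exposed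
  have hbexp : Exposed e b := by
    obtain ⟨ε, hε, hpos⟩ := exists_eps (fun i => ⟪N, e i⟫)
      (fun i => ⟪M, e b⟫ / ⟪h, e b⟫ * ⟪h, e i⟫ - ⟪M, e i⟫) (fun i => i ≠ b) (by
        intro i hib
        rcases (hN i).eq_or_lt with h0 | h0
        · right
          refine ⟨h0.symm, ?_⟩
          have := (div_lt_iff₀ (hh i)).1 (hfar i hib h0.symm)
          linarith
        · left; exact h0)
    refine ⟨N + ε • ((⟪M, e b⟫ / ⟪h, e b⟫) • h - M), ?_, ?_⟩
    · rw [inner_add_left, real_inner_smul_left, inner_sub_left, real_inner_smul_left, hNb,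
        div_mul_cancel₀ _ (hh b).ne']
      ring
    · intro i hi
      rw [inner_add_left, real_inner_smul_left, inner_sub_left, real_inner_smul_left]
      exact hpos i hi
  by_cases hb1 : b = a + 1
  · have ht' : t = 0 := by
      have h1 := hNi b
      rw [hNb, hb1, hFa1] at h1
      have h2 := hM (a + 1) ha1
      have h3 : t * ⟪M, e (a + 1)⟫ = 0 := by linarith
      exact (mul_eq_zero.1 h3).resolve_right h2.ne'
    refine ⟨fun i => ?_, hb1 ▸ hbexp⟩
    have := hN i
    rw [hNi, ht', zero_mul, sub_zero, hF, real_inner_smul_left] at this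
    exact this
  · exfalso
    have hb2 : a ≠ b + 1 := by
      intro hc
      have : b = a - 1 := by rw [hc]; ring
      rw [← this] at hNm
      exact hNm.ne' hNb
    have hDD := jordan3 hstar e he h M N a b hh hMa hM hN hNa hNb hdet hfar hba hb1 hb2 hD
    have m1 := arc_mem e he hcr N hN0 a hN hNa (hD a)
    have m2 := arc_mem e he hcr N hN0 b hN hNb (hD b)
    set D' := det3 (e (b - 1)) (e b) (e (b + 1)) with hD'def
    have hq : 0 < D' / D := by
      have := div_pos hDD (mul_self_pos.2 (hD a))
      have h2 : D * D' / (D * D) = D' / D := by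
        have := hD a
        field_simp
      rwa [h2] at this
    have hsame : ‖D' • N‖⁻¹ • (D' • N) = ‖D • N‖⁻¹ • (D • N) := by
      have e1 : D' • N = (D' / D) • (D • N) := by
        rw [smul_smul, div_mul_cancel₀ _ (show D ≠ 0 from hD a)]
      rw [e1, normalize_pos_smul _ hq]
    rw [hsame] at m2
    have hemp := (hG.2 (a - 1) (b - 1) (by simpa using hba.symm)).2.2
      (by intro hc; apply hb1; linear_combination hc) (by intro hc; apply hb2; linear_combination hc)
    have : ‖D • N‖⁻¹ • (D • N) ∈ (∅ : Set E3) := hemp ▸ ⟨m1, m2⟩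
    exact this

lemma exists_exposed {n : ℕ} [NeZero n] {v : E3} {w : ZMod n → E3} (hstar : IsStar v w)
    (e : ZMod n → E3) (he : ∀ i, e i = w i - v) (h : E3) (hh : ∀ i, 0 < ⟪h, e i⟫) :
    ∃ a, Exposed e a := by
  obtain ⟨a, -, hmax⟩ := Finset.exists_max_image (Finset.univ : Finset (ZMod n))
    (fun i => ‖(⟪h, e i⟫)⁻¹ • e i‖) ⟨0, Finset.mem_univ _⟩
  set p : ZMod n → E3 := fun i => (⟪h, e i⟫)⁻¹ • e i with hp
  have hep : ∀ i, e i = ⟪h, e i⟫ • p i := fun i => by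
    rw [hp]; simp only; rw [smul_inv_smul₀ (hh i).ne']
  have hhp : ∀ i, ⟪h, p i⟫ = 1 := fun i => by
    rw [hp]; simp only; rw [real_inner_smul_right, inv_mul_cancel₀ (hh i).ne']
  refine ⟨a, ‖p a‖ ^ 2 • h - p a, ?_, ?_⟩
  · rw [hep a, real_inner_smul_right, inner_sub_left, real_inner_smul_left, hhp,
      real_inner_self_eq_norm_sq]
    ring
  · intro i hi
    rw [hep i, real_inner_smul_right, inner_sub_left, real_inner_smul_left, hhp]
    apply mul_pos (hh i)
    have hne : p a - p i ≠ 0 := by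
      intro h0
      have h1 : p i = p a := (sub_eq_zero.1 h0).symm
      refine ray_inj hstar e he hi (r := ⟪h, e i⟫ * (⟪h, e a⟫)⁻¹)
        (mul_pos (hh i) (inv_pos.2 (hh a))) ?_
      calc e i = ⟪h, e i⟫ • p i := hep i
        _ = ⟪h, e i⟫ • p a := by rw [h1]
        _ = (⟪h, e i⟫ * (⟪h, e a⟫)⁻¹) • e a := by rw [mul_smul]
    have h1 : 0 < ‖p a - p i‖ ^ 2 := by positivity
    rw [norm_sub_sq_real] at h1
    have h2 : ‖p i‖ ^ 2 ≤ ‖p a‖ ^ 2 := by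
      have := hmax i (Finset.mem_univ _)
      gcongr
    linarith

/-- Theorem 2.8 (i), simplicial case, convexity of the Gauss image: for an embedded,
immersed simplicial vertex star whose Gauss image has no self-intersections and
whose discrete Gaussian curvature is positive, all the unit face normals lie in one
closed half-space bounded by the plane spanned by any two consecutive unit normals
`nᵢ, nᵢ₊₁`. -/
theorem stmt3 {n : ℕ} [NeZero n] (v : E3) (w : ZMod n → E3)
    (hstar : IsStar v w) (hG : GaussEmb v w) (hK : 0 < curv v w) :
    ∀ i : ZMod n, ∃ ε : ℝ, (ε = -1 ∨ ε = 1) ∧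
      ∀ j : ZMod n, 0 ≤ ε * ⟪starUN v w j, cross3 (starUN v w i) (starUN v w (i + 1))⟫ := by
  have hn : 3 ≤ n := hstar.1
  obtain ⟨e, he⟩ : ∃ e : ZMod n → E3, ∀ i, e i = w i - v := ⟨fun i => w i - v, fun _ => rfl⟩
  have hli : ∀ i, LinearIndependent ℝ ![e i, e (i + 1)] := by
    intro i; rw [he, he]; exact hstar.2.1 i
  have hcr : ∀ i, cross3 (e i) (e (i + 1)) ≠ 0 := fun i => cross_ne_zero (hli i)
  have hUN : ∀ i, starUN v w i = ‖cross3 (e i) (e (i + 1))‖⁻¹ • cross3 (e i) (e (i + 1)) := by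
    intro i; rw [starUN, starFN, he, he]
  have hD : ∀ i, det3 (e (i - 1)) (e i) (e (i + 1)) ≠ 0 := by
    intro i
    have h1 := hstar.2.2.1 (i - 1)
    have h2 := hcr (i - 1)
    rw [hUN, hUN] at h1
    simp only [sub_add_cancel] at h1 h2
    exact det_ne_zero h2 (hcr i) h1.1 h1.2
  -- the star lies in an open half-space
  obtain ⟨h, hh⟩ : ∃ h : E3, ∀ i, 0 < ⟪h, e i⟫ := by
    have hsum : ∑ i ∈ Finset.range n, InnerProductGeometry.angle (e (i : ℕ)) (e ((i + 1 : ℕ))) =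
        ∑ i : ZMod n, InnerProductGeometry.angle (w i - v) (w (i + 1) - v) := by
      refine Finset.sum_bij' (fun i _ => (i : ZMod n)) (fun i _ => i.val) ?_ ?_ ?_ ?_ ?_
      · intro i _; exact Finset.mem_univ _
      · intro i _; exact Finset.mem_range.2 (ZMod.val_lt i)
      · intro i hi; exact ZMod.val_cast_of_lt (Finset.mem_range.1 hi)
      · intro i _; exact ZMod.natCast_zmod_val i
      · intro i _; rw [he, he]; push_cast; rfl
    obtain ⟨h, hh⟩ := hemisphere (fun i : ℕ => e (i : ZMod n)) n (by omega) (by simp)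
      (by intro i _; simpa using hli (i : ZMod n)) (by
        rw [hsum]
        unfold curv at hK
        linarith)
    refine ⟨h, fun i => ?_⟩
    have := hh i.val (ZMod.val_lt i)
    simpa only [ZMod.natCast_zmod_val] using this
  -- all rays are exposed
  obtain ⟨a, ha⟩ := exists_exposed hstar e he h hh
  have hall' : ∀ k : ℕ, Exposed e (a + k) := by
    intro k
    induction k with
    | zero => simpa using ha
    | succ k ih =>
      have := (step hstar hG e he h hh hcr hD _ ih).2
      rwa [add_assoc, ← Nat.cast_succ] at this
  have hall : ∀ i, Exposed e i := by
    intro i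
    have := hall' (i - a).val
    rwa [ZMod.natCast_zmod_val, add_sub_cancel] at this
  have hsupp : ∀ j i, 0 ≤ det3 (e (j - 1)) (e j) (e (j + 1)) * ⟪cross3 (e j) (e (j + 1)), e i⟫ :=
    fun j => (step hstar hG e he h hh hcr hD j (hall j)).1
  set D : ZMod n → ℝ := fun i => det3 (e (i - 1)) (e i) (e (i + 1)) with hDdef
  have hDstep : ∀ i, 0 < D i * D (i + 1) := by
    intro i
    have h1 := hsupp i (i + 1 + 1)
    have h2 : ⟪cross3 (e i) (e (i + 1)), e (i + 1 + 1)⟫ = D (i + 1) := by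
      simp only [hDdef, add_sub_cancel_right]; rfl
    rw [h2] at h1
    exact lt_of_le_of_ne h1 (mul_ne_zero (hD i) (hD (i + 1))).symm
  have hDall' : ∀ (i : ZMod n) (k : ℕ), 0 < D i * D (i + k) := by
    intro i k
    induction k with
    | zero => simpa using mul_self_pos.2 (hD i)
    | succ k ih =>
      have h1 := hDstep (i + k)
      rw [Nat.cast_succ, ← add_assoc]
      have h2 := mul_pos ih h1
      have h3 : 0 < (D i * D (i + k + 1)) * (D (i + k)) ^ 2 := by
        refine lt_of_lt_of_eq h2 ?_; ring
      exact pos_of_mul_pos_left h3 (sq_nonneg _)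
  have hDall : ∀ i j : ZMod n, 0 < D i * D j := by
    intro i j
    have := hDall' i (j - i).val
    rwa [ZMod.natCast_zmod_val, add_sub_cancel] at this
  intro i
  refine ⟨1, Or.inr rfl, fun j => ?_⟩
  have hcross : cross3 (starUN v w i) (starUN v w (i + 1)) =
      (‖cross3 (e i) (e (i + 1))‖⁻¹ * ‖cross3 (e (i + 1)) (e (i + 1 + 1))‖⁻¹ * D (i + 1)) •
        e (i + 1) := by
    rw [hUN, hUN, cross_smul, cross3_cross3, smul_smul]
    simp only [hDdef, add_sub_cancel_right]
  rw [one_mul, hcross, hUN j, real_inner_smul_left, real_inner_smul_right]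
  have h1 := hsupp j (i + 1)
  have h2 : 0 ≤ D (i + 1) * ⟪cross3 (e j) (e (j + 1)), e (i + 1)⟫ := by
    have h3 := mul_nonneg h1 (hDall j (i + 1)).le
    have h4 : 0 ≤ (D (i + 1) * ⟪cross3 (e j) (e (j + 1)), e (i + 1)⟫) * (D j) ^ 2 := by
      refine le_of_le_of_eq h3 ?_
      simp only [hDdef]; ring
    exact nonneg_of_mul_nonneg_left h4 (by have := hD j; positivity)
  have h5 : ‖cross3 (e j) (e (j + 1))‖⁻¹ * (‖cross3 (e i) (e (i + 1))‖⁻¹ *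
      ‖cross3 (e (i + 1)) (e (i + 1 + 1))‖⁻¹ * D (i + 1) *
        ⟪cross3 (e j) (e (j + 1)), e (i + 1)⟫) =
      (‖cross3 (e j) (e (j + 1))‖⁻¹ * (‖cross3 (e i) (e (i + 1))‖⁻¹ *
      ‖cross3 (e (i + 1)) (e (i + 1 + 1))‖⁻¹)) * (D (i + 1) *
        ⟪cross3 (e j) (e (j + 1)), e (i + 1)⟫) := by ring
  rw [h5]
  exact mul_nonneg (by positivity) h2
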